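/- arXiv:2108.01275 — 5 statements merged into one kernel-verified Lean document; each statement's English description precedes it below -/
import Mathlib

section
/- For every g ∈ GL(2,F) there exists a unique natural number n such that g = c • (γ * diag(tⁿ, 1) * w) for some γ ∈ Γ₂, some w ∈ W₂ and some scalar c ∈ Fˣ (where diag(tⁿ,1) is the diagonal matrix with entries tⁿ and 1). -/
noncomputable section

set_option linter.unusedSectionVars false

open Matrix Polynomial

variable (K : Type) [Field K] [Fintype K]

/-- `u ∈ 𝔽_q((u))`, playing the role of `t⁻¹`. -/
def uu : LaurentSeries K := HahnSeries.single 1 1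

/-- `t = u⁻¹`, so that `LaurentSeries K` is identified with `𝔽_q((t⁻¹))`. -/
def tt : LaurentSeries K := (uu K)⁻¹

/-- The valuation ring `O = 𝔽_q[[t⁻¹]]`, the subring of power series in `u`. -/
def Osub : Subring (LaurentSeries K) := (HahnSeries.ofPowerSeries ℤ K).range

/-- The ring `R = 𝔽_q[t]`, the image of the polynomial ring under `X ↦ t`. -/
def Rsub : Subring (LaurentSeries K) :=
  (Polynomial.eval₂RingHom (HahnSeries.C : K →+* LaurentSeries K) (tt K)).range

/-- Membership in `Γ_d`: all entries of `g` and of `g⁻¹` lie in `R = 𝔽_q[t]`. -/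
def memGamma {d : ℕ} (g : GL (Fin d) (LaurentSeries K)) : Prop :=
  (∀ i j, (g : Matrix (Fin d) (Fin d) (LaurentSeries K)) i j ∈ Rsub K) ∧
  (∀ i j, ((g⁻¹ : GL (Fin d) (LaurentSeries K)) : Matrix (Fin d) (Fin d) (LaurentSeries K)) i j
      ∈ Rsub K)

/-- Membership in `W_d`: all entries of `g` and of `g⁻¹` lie in `O = 𝔽_q[[t⁻¹]]`. -/
def memW {d : ℕ} (g : GL (Fin d) (LaurentSeries K)) : Prop :=
  (∀ i j, (g : Matrix (Fin d) (Fin d) (LaurentSeries K)) i j ∈ Osub K) ∧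
  (∀ i j, ((g⁻¹ : GL (Fin d) (LaurentSeries K)) : Matrix (Fin d) (Fin d) (LaurentSeries K)) i j
      ∈ Osub K)


/-! ### Valuation facts -/

lemma uu_ne : uu K ≠ 0 := by
  simp [uu]

lemma tt_eq : tt K = HahnSeries.single (-1) 1 := by
  rw [tt, uu]
  refine inv_eq_of_mul_eq_one_right ?_
  rw [HahnSeries.single_mul_single]; simp

lemma tt_ne : tt K ≠ 0 := inv_ne_zero (uu_ne K)

lemma tt_pow (n : ℕ) : tt K ^ n = HahnSeries.single (-(n : ℤ)) 1 := by
  rw [tt_eq, HahnSeries.single_pow]; simp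

lemma order_tt_pow (n : ℕ) : (tt K ^ n).order = -(n : ℤ) := by
  rw [tt_pow]; exact HahnSeries.order_single one_ne_zero

lemma order_inv' {x : LaurentSeries K} (hx : x ≠ 0) : (x⁻¹).order = - x.order := by
  have h := HahnSeries.order_mul hx (inv_ne_zero hx)
  rw [mul_inv_cancel₀ hx, HahnSeries.order_one] at h
  linarith

lemma order_div' {x y : LaurentSeries K} (hx : x ≠ 0) (hy : y ≠ 0) :
    (x / y).order = x.order - y.order := by
  rw [div_eq_mul_inv, HahnSeries.order_mul hx (inv_ne_zero hy), order_inv' K hy]; ring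

lemma mem_O {x : LaurentSeries K} : x ∈ Osub K ↔ 0 ≤ x.order := by
  constructor
  · rintro ⟨p, rfl⟩
    by_cases h : HahnSeries.ofPowerSeries ℤ K p = 0
    · rw [h, HahnSeries.order_zero]
    by_contra! hlt
    have h1 := HahnSeries.coeff_order_eq_zero.not.mpr h
    apply h1
    rw [HahnSeries.ofPowerSeries_apply]
    apply HahnSeries.embDomain_of_notMem_range
    rintro ⟨n, hn⟩
    have : ((n : ℕ) : ℤ) = (HahnSeries.ofPowerSeries ℤ K p).order := by
      simpa [HahnSeries.ofPowerSeries_apply] using hn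
    omega
  · intro h
    rw [← LaurentSeries.single_order_mul_powerSeriesPart x]
    refine (Osub K).mul_mem ?_ ⟨_, rfl⟩
    obtain ⟨n, hn⟩ := Int.eq_ofNat_of_zero_le h
    rw [hn]
    exact ⟨PowerSeries.X ^ n, HahnSeries.ofPowerSeries_X_pow n⟩

lemma coeff_eval₂ (p : K[X]) (j : ℤ) (hj : 0 < j) :
    (Polynomial.eval₂RingHom (HahnSeries.C : K →+* LaurentSeries K) (tt K) p).coeff j = 0 := by
  induction p using Polynomial.induction_on' with
  | add p q hp hq => rw [map_add, HahnSeries.coeff_add, hp, hq, add_zero]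
  | monomial n a =>
    simp only [Polynomial.coe_eval₂RingHom, Polynomial.eval₂_monomial, tt_pow]
    rw [HahnSeries.C_apply, HahnSeries.single_mul_single]
    apply HahnSeries.coeff_single_of_ne
    omega

lemma order_R {x : LaurentSeries K} (hx : x ∈ Rsub K) (h0 : x ≠ 0) : x.order ≤ 0 := by
  obtain ⟨p, rfl⟩ := hx
  by_contra! h
  exact h0 (HahnSeries.coeff_order_eq_zero.mp (coeff_eval₂ K p _ h))

lemma exists_R (x : LaurentSeries K) : ∃ r ∈ Rsub K, x + r = 0 ∨ 0 < (x + r).order := by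
  obtain ⟨N, hN⟩ : ∃ N : ℕ, -(N : ℤ) < x.order := ⟨(1 - x.order).toNat, by omega⟩
  let p : K[X] := ∑ i ∈ Finset.range N, Polynomial.monomial i (x.coeff (-(i : ℤ)))
  let r := Polynomial.eval₂RingHom (HahnSeries.C : K →+* LaurentSeries K) (tt K) p
  have hr : r = ∑ i ∈ Finset.range N, HahnSeries.single (-(i : ℤ)) (x.coeff (-(i : ℤ))) := by
    simp only [r, p, map_sum]
    refine Finset.sum_congr rfl fun i _ => ?_
    simp only [Polynomial.coe_eval₂RingHom, Polynomial.eval₂_monomial, tt_pow]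
    rw [HahnSeries.C_apply, HahnSeries.single_mul_single]
    simp
  refine ⟨-r, (Rsub K).neg_mem ⟨p, rfl⟩, ?_⟩
  by_cases h : x + -r = 0
  · exact Or.inl h
  right
  by_contra! hle
  apply HahnSeries.coeff_order_eq_zero.not.mpr h
  generalize (x + -r).order = j at hle
  rw [HahnSeries.coeff_add, HahnSeries.coeff_neg, hr, HahnSeries.coeff_sum]
  obtain ⟨i, rfl⟩ : ∃ i : ℕ, j = -(i : ℤ) := ⟨(-j).toNat, by omega⟩
  by_cases hi : i < N
  · rw [Finset.sum_eq_single i]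
    · simp
    · intro b _ hb
      apply HahnSeries.coeff_single_of_ne
      omega
    · intro h; simp at h; omega
  · rw [Finset.sum_eq_zero, HahnSeries.coeff_eq_zero_of_lt_order (by omega)]
    · simp
    · intro b hb
      simp at hb
      apply HahnSeries.coeff_single_of_ne
      omega

/-! ### Matrices over a subring -/

/-- `g` and `g⁻¹` have entries in `S`. -/
def memS {F : Type} [Field F] (S : Subring F) (g : GL (Fin 2) F) : Prop :=
  (∀ i j, (g : Matrix (Fin 2) (Fin 2) F) i j ∈ S) ∧
  (∀ i j, ((g⁻¹ : GL (Fin 2) F) : Matrix (Fin 2) (Fin 2) F) i j ∈ S)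

section
variable {F : Type} [Field F] {S : Subring F}

lemma memS.mul {g h : GL (Fin 2) F} (hg : memS S g) (hh : memS S h) : memS S (g * h) := by
  constructor
  · intro i j
    rw [Units.val_mul, Matrix.mul_apply]
    exact S.sum_mem fun k _ => S.mul_mem (hg.1 _ _) (hh.1 _ _)
  · intro i j
    rw [_root_.mul_inv_rev, Units.val_mul, Matrix.mul_apply]
    exact S.sum_mem fun k _ => S.mul_mem (hh.2 _ _) (hg.2 _ _)

lemma memS.inv {g : GL (Fin 2) F} (hg : memS S g) : memS S g⁻¹ := ⟨hg.2, by simpa using hg.1⟩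

lemma memS.one : memS S 1 := by
  have : ∀ i j, (1 : Matrix (Fin 2) (Fin 2) F) i j ∈ S := by
    intro i j
    rw [Matrix.one_apply]; split_ifs
    exacts [S.one_mem, S.zero_mem]
  exact ⟨by simpa using this, by simpa using this⟩

lemma memS.det {g : GL (Fin 2) F} (hg : memS S g) : (g : Matrix (Fin 2) (Fin 2) F).det ∈ S := by
  rw [Matrix.det_fin_two]
  exact S.sub_mem (S.mul_mem (hg.1 _ _) (hg.1 _ _)) (S.mul_mem (hg.1 _ _) (hg.1 _ _))

/-- Build an element from a matrix and its inverse. -/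
lemma exists_memS (a b c d a' b' c' d' : F) (ha : a ∈ S) (hb : b ∈ S) (hc : c ∈ S) (hd : d ∈ S)
    (ha' : a' ∈ S) (hb' : b' ∈ S) (hc' : c' ∈ S) (hd' : d' ∈ S)
    (h1 : !![a, b; c, d] * !![a', b'; c', d'] = 1) :
    ∃ g : GL (Fin 2) F, memS S g ∧ (g : Matrix (Fin 2) (Fin 2) F) = !![a, b; c, d] := by
  refine ⟨⟨!![a, b; c, d], !![a', b'; c', d'], h1, mul_eq_one_comm.mp h1⟩, ⟨?_, ?_⟩, rfl⟩
  · intro i j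
    fin_cases i <;> fin_cases j <;> simpa
  · intro i j
    rw [Units.inv_mk]
    fin_cases i <;> fin_cases j <;> simpa

variable (S) in
lemma exists_memS_swap :
    ∃ g : GL (Fin 2) F, memS S g ∧ (g : Matrix (Fin 2) (Fin 2) F) = !![0, 1; 1, 0] :=
  exists_memS 0 1 1 0 0 1 1 0 S.zero_mem S.one_mem S.one_mem S.zero_mem S.zero_mem S.one_mem
    S.one_mem S.zero_mem (by refine Matrix.ext fun i j => ?_; fin_cases i <;> fin_cases j <;> simp)

lemma exists_upper {r : F} (hr : r ∈ S) :
    ∃ g : GL (Fin 2) F, memS S g ∧ (g : Matrix (Fin 2) (Fin 2) F) = !![1, r; 0, 1] :=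
  exists_memS 1 r 0 1 1 (-r) 0 1 S.one_mem hr S.zero_mem S.one_mem S.one_mem (S.neg_mem hr)
    S.zero_mem S.one_mem (by refine Matrix.ext fun i j => ?_; fin_cases i <;> fin_cases j <;> simp)

lemma exists_lower {r : F} (hr : r ∈ S) :
    ∃ g : GL (Fin 2) F, memS S g ∧ (g : Matrix (Fin 2) (Fin 2) F) = !![1, 0; r, 1] :=
  exists_memS 1 0 r 1 1 0 (-r) 1 S.one_mem S.zero_mem hr S.one_mem S.one_mem S.zero_mem
    (S.neg_mem hr) S.one_mem (by refine Matrix.ext fun i j => ?_; fin_cases i <;> fin_cases j <;> simp)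

lemma exists_diag {r : F} (hr : r ∈ S) (hr' : r⁻¹ ∈ S) (h0 : r ≠ 0) :
    ∃ g : GL (Fin 2) F, memS S g ∧ (g : Matrix (Fin 2) (Fin 2) F) = !![r, 0; 0, 1] :=
  exists_memS r 0 0 1 r⁻¹ 0 0 1 hr S.zero_mem S.zero_mem S.one_mem hr' S.zero_mem S.zero_mem
    S.one_mem (by refine Matrix.ext fun i j => ?_; fin_cases i <;> fin_cases j <;> simp [h0])

end

/-! ### Existence -/

/-- `M` has a decomposition. -/
def HasDec (M : Matrix (Fin 2) (Fin 2) (LaurentSeries K)) : Prop :=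
  ∃ n : ℕ, ∃ (γ w : GL (Fin 2) (LaurentSeries K)) (c : (LaurentSeries K)ˣ),
      memS (Rsub K) γ ∧ memS (Osub K) w ∧
      M = (c : LaurentSeries K) •
          ((γ : Matrix (Fin 2) (Fin 2) (LaurentSeries K)) *
            Matrix.diagonal ![tt K ^ n, 1] *
            (w : Matrix (Fin 2) (Fin 2) (LaurentSeries K)))

variable {K}

lemma HasDec.of_left {M : Matrix (Fin 2) (Fin 2) (LaurentSeries K)}
    {δ : GL (Fin 2) (LaurentSeries K)} (hδ : memS (Rsub K) δ)
    (h : HasDec K ((δ : Matrix (Fin 2) (Fin 2) (LaurentSeries K)) * M)) : HasDec K M := by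
  obtain ⟨n, γ, w, c, hγ, hw, e⟩ := h
  refine ⟨n, δ⁻¹ * γ, w, c, hδ.inv.mul hγ, hw, ?_⟩
  have := congrArg (fun X => ((δ⁻¹ : GL (Fin 2) (LaurentSeries K)) :
    Matrix (Fin 2) (Fin 2) (LaurentSeries K)) * X) e
  simp only [← Matrix.mul_assoc, Units.inv_mul, Matrix.one_mul, Matrix.mul_smul] at this
  rw [this, Units.val_mul]

lemma HasDec.of_right {M : Matrix (Fin 2) (Fin 2) (LaurentSeries K)}
    {δ : GL (Fin 2) (LaurentSeries K)} (hδ : memS (Osub K) δ)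
    (h : HasDec K (M * (δ : Matrix (Fin 2) (Fin 2) (LaurentSeries K)))) : HasDec K M := by
  obtain ⟨n, γ, w, c, hγ, hw, e⟩ := h
  refine ⟨n, γ, w * δ⁻¹, c, hγ, hw.mul hδ.inv, ?_⟩
  have := congrArg (fun X => X * ((δ⁻¹ : GL (Fin 2) (LaurentSeries K)) :
    Matrix (Fin 2) (Fin 2) (LaurentSeries K))) e
  simp only [Matrix.mul_assoc, Units.mul_inv, Matrix.mul_one, Matrix.smul_mul] at this
  rw [this, Units.val_mul, Matrix.mul_assoc]

lemma HasDec.of_smul {M : Matrix (Fin 2) (Fin 2) (LaurentSeries K)}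
    {a : LaurentSeries K} (ha : a ≠ 0) (h : HasDec K (a • M)) : HasDec K M := by
  obtain ⟨n, γ, w, c, hγ, hw, e⟩ := h
  refine ⟨n, γ, w, (Units.mk0 a ha)⁻¹ * c, hγ, hw, ?_⟩
  rw [Units.val_mul, mul_smul, ← e, smul_smul]
  simp [ha]

lemma hasDec_diag_nonpos {a : LaurentSeries K} (ha : a ≠ 0) (h : a.order ≤ 0) :
    HasDec K !![a, 0; 0, 1] := by
  obtain ⟨n, hn⟩ : ∃ n : ℕ, a.order = -(n : ℤ) := ⟨(-a.order).toNat, by omega⟩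
  have ht : tt K ^ n ≠ 0 := pow_ne_zero _ (tt_ne K)
  have hr : a / tt K ^ n ≠ 0 := div_ne_zero ha ht
  have ho : (a / tt K ^ n).order = 0 := by
    rw [order_div' K ha ht, hn, order_tt_pow]; ring
  obtain ⟨w, hw, e⟩ := exists_diag (S := Osub K) (r := a / tt K ^ n) ((mem_O K).2 ho.ge)
    ((mem_O K).2 (by rw [order_inv' K hr, ho]; simp)) hr
  refine ⟨n, 1, w, 1, memS.one, hw, ?_⟩
  rw [e]
  refine Matrix.ext fun i j => ?_
  fin_cases i <;> fin_cases j <;> simp [Matrix.mul_apply, mul_div_cancel₀, ht]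

lemma hasDec_diag {a : LaurentSeries K} (ha : a ≠ 0) : HasDec K !![a, 0; 0, 1] := by
  rcases le_or_gt a.order 0 with h | h
  · exact hasDec_diag_nonpos ha h
  · obtain ⟨s, hs, es⟩ := exists_memS_swap (Rsub K)
    obtain ⟨s', hs', es'⟩ := exists_memS_swap (Osub K)
    refine HasDec.of_left hs (HasDec.of_right hs' (HasDec.of_smul (inv_ne_zero ha) ?_))
    have := hasDec_diag_nonpos (inv_ne_zero ha) (by rw [order_inv' K ha]; omega)
    rw [es, es']
    convert this using 1
    refine Matrix.ext fun i j => ?_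
    fin_cases i <;> fin_cases j <;> simp [ha]

lemma hasDec_upper (N : ℕ) : ∀ a b : LaurentSeries K, a ≠ 0 → a.order ≤ N →
    HasDec K !![a, b; 0, 1] := by
  induction N using Nat.strong_induction_on with
  | _ N ih =>
  intro a b' ha hN
  obtain ⟨r, hr, hb⟩ := exists_R K b'
  obtain ⟨g, hg, eg⟩ := exists_upper hr
  refine HasDec.of_left hg ?_
  have e1 : (g : Matrix (Fin 2) (Fin 2) (LaurentSeries K)) * !![a, b'; 0, 1]
      = !![a, b' + r; 0, 1] := by
    rw [eg]; refine Matrix.ext fun i j => ?_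
    fin_cases i <;> fin_cases j <;> simp
  rw [e1]
  generalize b' + r = b at hb
  by_cases hb0 : b = 0
  · rw [hb0]; exact hasDec_diag ha
  replace hb := hb.resolve_left hb0
  rcases le_or_gt a.order b.order with hab | hab
  · obtain ⟨w, hw, ew⟩ := exists_upper (S := Osub K) (r := -(b / a))
      ((Osub K).neg_mem ((mem_O K).2 (by rw [order_div' K hb0 ha]; omega)))
    refine HasDec.of_right hw ?_
    rw [ew]
    convert hasDec_diag ha using 1
    refine Matrix.ext fun i j => ?_
    fin_cases i <;> fin_cases j <;> simp
    field_simp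
    simp
  · obtain ⟨s, hs, es⟩ := exists_memS_swap (Rsub K)
    obtain ⟨w, hw, ew⟩ := exists_lower (S := Osub K) (r := -(a / b))
      ((Osub K).neg_mem ((mem_O K).2 (by rw [order_div' K ha hb0]; omega)))
    refine HasDec.of_left hs (HasDec.of_right hw (HasDec.of_smul (inv_ne_zero hb0) ?_))
    have hbb : b * b ≠ 0 := mul_ne_zero hb0 hb0
    have ho : (-(a / (b * b))).order = a.order - (b.order + b.order) := by
      rw [HahnSeries.order_neg, order_div' K ha hbb, HahnSeries.order_mul hb0 hb0]
    have := ih (N - 1) (by omega) (-(a / (b * b))) b⁻¹ (neg_ne_zero.2 (div_ne_zero ha hbb))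
      (by rw [ho]; omega)
    rw [es, ew]
    convert this using 1
    refine Matrix.ext fun i j => ?_
    fin_cases i <;> fin_cases j <;> simp [hb0]
    · field_simp
    · rw [mul_div_cancel₀ _ hb0, add_neg_cancel]

lemma hasDec_aux {a b c d : LaurentSeries K} (hdet : a * d - b * c ≠ 0) (hd : d ≠ 0)
    (hcd : c / d ∈ Osub K) : HasDec K !![a, b; c, d] := by
  obtain ⟨w, hw, ew⟩ := exists_lower (S := Osub K) ((Osub K).neg_mem hcd)
  refine HasDec.of_right hw (HasDec.of_smul (inv_ne_zero hd) ?_)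
  have := hasDec_upper (((a * d - b * c) / (d * d)).order.toNat) ((a * d - b * c) / (d * d))
    (b / d) (div_ne_zero hdet (mul_ne_zero hd hd)) (by omega)
  rw [ew]
  convert this using 1
  refine Matrix.ext fun i j => ?_
  fin_cases i <;> fin_cases j <;> simp [hd] <;> field_simp <;> ring

lemma hasDec_all {a b c d : LaurentSeries K} (hdet : a * d - b * c ≠ 0) :
    HasDec K !![a, b; c, d] := by
  by_cases h : d ≠ 0 ∧ c / d ∈ Osub K
  · exact hasDec_aux hdet h.1 h.2
  · obtain ⟨s, hs, es⟩ := exists_memS_swap (Osub K)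
    refine HasDec.of_right hs ?_
    have e : !![a, b; c, d] * (s : Matrix (Fin 2) (Fin 2) (LaurentSeries K)) = !![b, a; d, c] := by
      rw [es]; refine Matrix.ext fun i j => ?_
      fin_cases i <;> fin_cases j <;> simp
    rw [e]
    have hc : c ≠ 0 := by
      rintro rfl
      apply h
      refine ⟨?_, ?_⟩
      · rintro rfl; simp at hdet
      · simpa using (Osub K).zero_mem
    refine hasDec_aux (fun h0 => hdet (by linear_combination -h0)) hc ?_
    by_cases hd : d = 0
    · rw [hd, zero_div]; exact (Osub K).zero_mem
    have h2 : ¬ c / d ∈ Osub K := fun h3 => h ⟨hd, h3⟩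
    rw [mem_O, order_div' K hc hd] at h2
    rw [mem_O, order_div' K hd hc]
    omega

/-! ### Uniqueness -/

lemma order_det_R {γ : GL (Fin 2) (LaurentSeries K)} (h : memS (Rsub K) γ) :
    (γ : Matrix (Fin 2) (Fin 2) (LaurentSeries K)).det.order = 0 := by
  have h1 : (γ : Matrix (Fin 2) (Fin 2) (LaurentSeries K)).det *
      ((γ⁻¹ : GL (Fin 2) (LaurentSeries K)) : Matrix (Fin 2) (Fin 2) (LaurentSeries K)).det = 1 := by
    rw [← Matrix.det_mul, Units.mul_inv, Matrix.det_one]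
  have a := left_ne_zero_of_mul_eq_one h1
  have b := right_ne_zero_of_mul_eq_one h1
  have h2 := HahnSeries.order_mul a b
  rw [h1, HahnSeries.order_one] at h2
  have := order_R K h.det a
  have := order_R K h.inv.det b
  omega

lemma order_det_O {γ : GL (Fin 2) (LaurentSeries K)} (h : memS (Osub K) γ) :
    (γ : Matrix (Fin 2) (Fin 2) (LaurentSeries K)).det.order = 0 := by
  have h1 : (γ : Matrix (Fin 2) (Fin 2) (LaurentSeries K)).det *
      ((γ⁻¹ : GL (Fin 2) (LaurentSeries K)) : Matrix (Fin 2) (Fin 2) (LaurentSeries K)).det = 1 := by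
    rw [← Matrix.det_mul, Units.mul_inv, Matrix.det_one]
  have a := left_ne_zero_of_mul_eq_one h1
  have b := right_ne_zero_of_mul_eq_one h1
  have h2 := HahnSeries.order_mul a b
  rw [h1, HahnSeries.order_one] at h2
  have := (mem_O K).1 h.det
  have := (mem_O K).1 h.inv.det
  omega

lemma det_ne (γ : GL (Fin 2) (LaurentSeries K)) :
    (γ : Matrix (Fin 2) (Fin 2) (LaurentSeries K)).det ≠ 0 :=
  ((Matrix.isUnit_iff_isUnit_det _).1 γ.isUnit).ne_zero

lemma zero_of_R_mul {x y z : LaurentSeries K} (hx : x ∈ Rsub K) (hz : z ∈ Osub K)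
    (hy : y ≠ 0) (ho : 0 < y.order) (e : x = y * z) : x = 0 := by
  by_contra h
  have hz0 : z ≠ 0 := by rintro rfl; simp at e; exact h e
  have h1 := order_R K hx h
  rw [e, HahnSeries.order_mul hy hz0] at h1
  have := (mem_O K).1 hz
  omega

lemma le_of_eq_dec {n m : ℕ} {γ w : GL (Fin 2) (LaurentSeries K)} {c : LaurentSeries K}
    (hc : c ≠ 0) (hγ : memS (Rsub K) γ) (hw : memS (Osub K) w)
    (e : (γ : Matrix (Fin 2) (Fin 2) (LaurentSeries K)) * Matrix.diagonal ![tt K ^ n, 1] =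
      c • (Matrix.diagonal ![tt K ^ m, 1] * (w : Matrix (Fin 2) (Fin 2) (LaurentSeries K)))) :
    m ≤ n := by
  have htn : tt K ^ n ≠ 0 := pow_ne_zero _ (tt_ne K)
  have htm : tt K ^ m ≠ 0 := pow_ne_zero _ (tt_ne K)
  have hdet := congrArg (fun X => (Matrix.det X).order) e
  simp only [Matrix.det_mul, Matrix.det_smul, Matrix.det_diagonal, Fin.prod_univ_two,
    Matrix.cons_val_zero, Matrix.cons_val_one, mul_one, Fintype.card_fin, pow_two] at hdet
  rw [HahnSeries.order_mul (det_ne γ) htn,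
    HahnSeries.order_mul (mul_ne_zero hc hc) (mul_ne_zero htm (det_ne w)),
    HahnSeries.order_mul hc hc, HahnSeries.order_mul htm (det_ne w), order_det_R hγ,
    order_det_O hw, order_tt_pow, order_tt_pow] at hdet
  by_contra! hlt
  have hco : 0 < c.order := by omega
  have e10 := congrFun (congrFun e 1) 0
  have e11 := congrFun (congrFun e 1) 1
  simp only [Matrix.mul_diagonal, Matrix.smul_apply, Matrix.diagonal_mul, Matrix.cons_val_zero,
    Matrix.cons_val_one, mul_one, one_mul, smul_eq_mul] at e10 e11
  have z11 := zero_of_R_mul (hγ.1 1 1) (hw.1 1 1) hc hco e11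
  have ht : tt K ^ n ∈ Rsub K := (Rsub K).pow_mem ⟨Polynomial.X, by simp⟩ n
  have z10 := zero_of_R_mul ((Rsub K).mul_mem (hγ.1 1 0) ht) (hw.1 1 0) hc hco e10
  have z10' := (mul_eq_zero.1 z10).resolve_right htn
  apply det_ne γ
  rw [Matrix.det_fin_two, z11, z10']; simp

lemma le_of_two {n m : ℕ} {γ w γ' w' : GL (Fin 2) (LaurentSeries K)} {c c' : (LaurentSeries K)ˣ}
    (hγ : memS (Rsub K) γ) (hw : memS (Osub K) w)
    (hγ' : memS (Rsub K) γ') (hw' : memS (Osub K) w')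
    (e : (c : LaurentSeries K) • ((γ : Matrix (Fin 2) (Fin 2) (LaurentSeries K)) *
        Matrix.diagonal ![tt K ^ n, 1] * (w : Matrix (Fin 2) (Fin 2) (LaurentSeries K))) =
      (c' : LaurentSeries K) • ((γ' : Matrix (Fin 2) (Fin 2) (LaurentSeries K)) *
        Matrix.diagonal ![tt K ^ m, 1] * (w' : Matrix (Fin 2) (Fin 2) (LaurentSeries K)))) :
    m ≤ n := by
  refine le_of_eq_dec (γ := γ'⁻¹ * γ) (w := w' * w⁻¹) (c := ((c⁻¹ * c' : (LaurentSeries K)ˣ) :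
    LaurentSeries K)) (Units.ne_zero _) (hγ'.inv.mul hγ) (hw'.mul hw.inv) ?_
  have h := congrArg (fun X => ((c⁻¹ : (LaurentSeries K)ˣ) : LaurentSeries K) •
    (((γ'⁻¹ : GL (Fin 2) (LaurentSeries K)) : Matrix (Fin 2) (Fin 2) (LaurentSeries K)) * X *
    ((w⁻¹ : GL (Fin 2) (LaurentSeries K)) : Matrix (Fin 2) (Fin 2) (LaurentSeries K)))) e
  simp only [Matrix.mul_smul, Matrix.smul_mul, smul_smul, Units.inv_mul, one_smul,
    Matrix.mul_assoc, Units.mul_inv, Matrix.mul_one] at h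
  simp only [← Matrix.mul_assoc, Units.inv_mul, Matrix.one_mul] at h
  simp only [Units.val_mul, ← Matrix.mul_assoc]
  exact h

variable (K)

/-- For every `g ∈ GL(2,F)` there is a unique `n : ℕ` such that
`g = c • (γ * diag(tⁿ,1) * w)` with `γ ∈ Γ₂`, `w ∈ W₂` and `c ∈ Fˣ` a scalar. -/
theorem cartan_decomposition_GL2 (g : GL (Fin 2) (LaurentSeries K)) :
    ∃! n : ℕ, ∃ (γ w : GL (Fin 2) (LaurentSeries K)) (c : (LaurentSeries K)ˣ),
      memGamma K γ ∧ memW K w ∧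
      (g : Matrix (Fin 2) (Fin 2) (LaurentSeries K)) =
        (c : LaurentSeries K) •
          ((γ : Matrix (Fin 2) (Fin 2) (LaurentSeries K)) *
            Matrix.diagonal ![tt K ^ n, 1] *
            (w : Matrix (Fin 2) (Fin 2) (LaurentSeries K))) := by
  have hM : HasDec K (g : Matrix (Fin 2) (Fin 2) (LaurentSeries K)) := by
    rw [Matrix.eta_fin_two (g : Matrix (Fin 2) (Fin 2) (LaurentSeries K))]
    apply hasDec_all
    rw [← Matrix.det_fin_two]
    exact det_ne g
  obtain ⟨n, γ, w, c, hγ, hw, e⟩ := hM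
  refine ⟨n, ⟨γ, w, c, hγ, hw, e⟩, ?_⟩
  rintro m ⟨γ', w', c', hγ', hw', e'⟩
  rw [e] at e'
  exact le_antisymm (le_of_two hγ hw hγ' hw' e') (le_of_two hγ' hw' hγ hw e'.symm)
end
end

section
/- Let (s₁,s₂,s₃) ∈ S be such that s₁, s₂, s₃ are pairwise distinct, and let f : V → ℂ be a simultaneous (λ⁺,λ⁻)-eigenfunction with f(v_{0,0}) = 1. Then for every (m,n) ∈ V, f(v_{m,n}) = Σ_{(i,j), i≠j} B_{i,j} q^m s_i^m s_j^n, where the sum runs over ordered pairs of distinct indices (i,j) ∈ {1,2,3}², and, with k the remaining index, B_{i,j} = (s_i − q s_j)(s_i − q s_k)(s_j − q s_k) / ((s_i − s_j)(s_i − s_k)(s_j − s_k)(q+1)(q²+q+1)). -/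
set_option linter.unusedSectionVars false

noncomputable section

open Filter

/-- The index set `V = {(m,n) ∈ ℕ × ℕ : n ≤ m}` of vertices `v_{m,n}` of the quotient
complex. -/
def Vtx : Type := {p : ℕ × ℕ // p.2 ≤ p.1}

/-- The weight `w(v_{m,n})`. -/
def wt (q : ℕ) (p : ℕ × ℕ) : ℝ :=
  if p.1 = 0 then 1 / ((q : ℝ)^2 + q + 1)
  else if p.2 = 0 ∨ p.2 = p.1 then 1 / (q : ℝ)^(2 * p.1)
  else ((q : ℝ) + 1) / (q : ℝ)^(2 * p.1)

/-- The weighted adjacency operator `A_w^+`. -/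
def Aplus (q : ℕ) (f : ℕ → ℕ → ℂ) : ℕ → ℕ → ℂ := fun m n =>
  if m = 0 then ((q : ℂ)^2 + q + 1) * f 1 0
  else if n = 0 then f (m+1) 0 + ((q : ℂ)^2 + q) * f m 1
  else if n = m then (q : ℂ)^2 * f (m-1) (m-1) + ((q : ℂ) + 1) * f (m+1) m
  else (q : ℂ)^2 * f (m-1) (n-1) + (q : ℂ) * f m (n+1) + f (m+1) n

/-- The weighted adjacency operator `A_w^-`. -/
def Aminus (q : ℕ) (f : ℕ → ℕ → ℂ) : ℕ → ℕ → ℂ := fun m n =>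
  if m = 0 then ((q : ℂ)^2 + q + 1) * f 1 1
  else if n = 0 then (q : ℂ)^2 * f (m-1) 0 + ((q : ℂ) + 1) * f (m+1) 1
  else if n = m then ((q : ℂ)^2 + q) * f m (m-1) + f (m+1) (m+1)
  else (q : ℂ)^2 * f (m-1) n + (q : ℂ) * f m (n-1) + f (m+1) (n+1)

/-- The squared weighted `L²` norm `‖f‖²_w = Σ_{(m,n) ∈ V} |f(v_{m,n})|² w(v_{m,n})`. -/
def normSqW (q : ℕ) (f : ℕ → ℕ → ℂ) : ℝ :=
  ∑' p : Vtx, ‖f p.1.1 p.1.2‖^2 * wt q p.1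

/-- `f ∈ L²_w`: the defining sum of `‖f‖²_w` is finite (summable). -/
def MemL2 (q : ℕ) (f : ℕ → ℕ → ℂ) : Prop :=
  Summable fun p : Vtx => ‖f p.1.1 p.1.2‖^2 * wt q p.1

/-- `f` is a simultaneous `(λ⁺,λ⁻)`-eigenfunction of `A_w^+` and `A_w^-`. -/
def IsEigen (q : ℕ) (f : ℕ → ℕ → ℂ) (lp lm : ℂ) : Prop :=
  ∀ m n : ℕ, n ≤ m → Aplus q f m n = lp * f m n ∧ Aminus q f m n = lm * f m n

/-- The coefficient `B_{i,j}` (with arguments `(s_i, s_j, s_k)`). -/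
def Bc (q : ℕ) (si sj sk : ℂ) : ℂ :=
  ((si - q * sj) * (si - q * sk) * (sj - q * sk)) /
    ((si - sj) * (si - sk) * (sj - sk) * ((q : ℂ) + 1) * ((q : ℂ)^2 + q + 1))

/-- The eigenfunction `f_s(v_{m,n}) = Σ_{(i,j), i ≠ j} B_{i,j} q^m s_i^m s_j^n`. -/
def fs (q : ℕ) (s1 s2 s3 : ℂ) : ℕ → ℕ → ℂ := fun m n =>
  Bc q s1 s2 s3 * (q : ℂ)^m * s1^m * s2^n + Bc q s1 s3 s2 * (q : ℂ)^m * s1^m * s3^n +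
  Bc q s2 s1 s3 * (q : ℂ)^m * s2^m * s1^n + Bc q s2 s3 s1 * (q : ℂ)^m * s2^m * s3^n +
  Bc q s3 s1 s2 * (q : ℂ)^m * s3^m * s1^n + Bc q s3 s2 s1 * (q : ℂ)^m * s3^m * s2^n

/-- The damped function `f_s^ε(v_{m,n}) = (1-ε)^m f_s(v_{m,n})`. -/
def fse (q : ℕ) (s1 s2 s3 : ℂ) (ε : ℝ) : ℕ → ℕ → ℂ := fun m n =>
  ((1 - ε : ℝ) : ℂ)^m * fs q s1 s2 s3 m n

section helpers

variable (q : ℕ) (s1 s2 s3 : ℂ)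

theorem aux_q1 : (q : ℂ) + 1 ≠ 0 := by exact_mod_cast Nat.succ_ne_zero q

theorem aux_q2 : (q : ℂ)^2 + q + 1 ≠ 0 := by exact_mod_cast Nat.succ_ne_zero (q^2 + q)

/-- First wall relation for the coefficients. -/
theorem Bc_rel_right :
    Bc q s1 s2 s3 * (q * s2 - s3) + Bc q s1 s3 s2 * (q * s3 - s2) = 0 := by
  have e : Bc q s1 s3 s2 = -(((s1 - q * s2) * (s1 - q * s3) * (s3 - q * s2)) /
    ((s1 - s2) * (s1 - s3) * (s2 - s3) * ((q : ℂ) + 1) * ((q : ℂ)^2 + q + 1))) := by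
    unfold Bc
    rw [← div_neg]
    congr 1 <;> ring
  rw [e]
  unfold Bc
  ring

/-- Second wall relation for the coefficients. -/
theorem Bc_rel_left :
    Bc q s1 s2 s3 * (q * s1 - s2) + Bc q s2 s1 s3 * (q * s2 - s1) = 0 := by
  have e : Bc q s2 s1 s3 = -(((s2 - q * s1) * (s1 - q * s3) * (s2 - q * s3)) /
    ((s1 - s2) * (s1 - s3) * (s2 - s3) * ((q : ℂ) + 1) * ((q : ℂ)^2 + q + 1))) := by
    unfold Bc
    rw [← div_neg]
    congr 1 <;> ring
  rw [e]
  unfold Bc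
  ring

theorem Bc_mul (h12 : s1 ≠ s2) (h13 : s1 ≠ s3) (h23 : s2 ≠ s3) :
    Bc q s1 s2 s3 * ((s1 - s2) * (s1 - s3) * (s2 - s3) * ((q : ℂ) + 1) * ((q : ℂ)^2 + q + 1)) =
      (s1 - q * s2) * (s1 - q * s3) * (s2 - q * s3) := by
  unfold Bc
  exact div_mul_cancel₀ _ (mul_ne_zero (mul_ne_zero (mul_ne_zero (mul_ne_zero
    (sub_ne_zero.2 h12) (sub_ne_zero.2 h13)) (sub_ne_zero.2 h23)) (aux_q1 q)) (aux_q2 q))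

theorem fs_base (h12 : s1 ≠ s2) (h13 : s1 ≠ s3) (h23 : s2 ≠ s3) :
    fs q s1 s2 s3 0 0 = 1 ∧
    ((q : ℂ)^2 + q + 1) * fs q s1 s2 s3 1 0 = q * (s1 + s2 + s3) ∧
    ((q : ℂ)^2 + q + 1) * fs q s1 s2 s3 1 1 = q * (s2 * s3 + s1 * s3 + s1 * s2) := by
  have a1 := aux_q1 q
  have a2 := aux_q2 q
  set E : ℂ := (s1 - s2) * (s1 - s3) * (s2 - s3) * ((q : ℂ) + 1) * ((q : ℂ)^2 + q + 1) with hE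
  have hE0 : E ≠ 0 := by
    rw [hE]
    exact mul_ne_zero (mul_ne_zero (mul_ne_zero (mul_ne_zero (sub_ne_zero.2 h12) (sub_ne_zero.2 h13)) (sub_ne_zero.2 h23)) a1) a2
  have b1 : Bc q s1 s2 s3 * E = (s1 - q * s2) * (s1 - q * s3) * (s2 - q * s3) := by
    rw [hE]
    linear_combination Bc_mul q s1 s2 s3 h12 h13 h23
  have b2 : Bc q s1 s3 s2 * E = -((s1 - q * s3) * (s1 - q * s2) * (s3 - q * s2)) := by
    rw [hE]
    linear_combination (-1 : ℂ) * Bc_mul q s1 s3 s2 h13 h12 h23.symm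
  have b3 : Bc q s2 s1 s3 * E = -((s2 - q * s1) * (s2 - q * s3) * (s1 - q * s3)) := by
    rw [hE]
    linear_combination (-1 : ℂ) * Bc_mul q s2 s1 s3 h12.symm h23 h13
  have b4 : Bc q s2 s3 s1 * E = (s2 - q * s3) * (s2 - q * s1) * (s3 - q * s1) := by
    rw [hE]
    linear_combination Bc_mul q s2 s3 s1 h23 h12.symm h13.symm
  have b5 : Bc q s3 s1 s2 * E = (s3 - q * s1) * (s3 - q * s2) * (s1 - q * s2) := by
    rw [hE]
    linear_combination Bc_mul q s3 s1 s2 h13.symm h23.symm h12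
  have b6 : Bc q s3 s2 s1 * E = -((s3 - q * s2) * (s3 - q * s1) * (s2 - q * s1)) := by
    rw [hE]
    linear_combination (-1 : ℂ) * Bc_mul q s3 s2 s1 h23.symm h13.symm h12.symm
  refine ⟨?_, ?_, ?_⟩ <;> apply mul_right_cancel₀ hE0 <;> unfold fs
  · linear_combination b1 + b2 + b3 + b4 + b5 + b6 - hE
  · linear_combination ((q : ℂ)^2 + q + 1) * q * (s1 * (b1 + b2) + s2 * (b3 + b4) + s3 * (b5 + b6))
      - q * (s1 + s2 + s3) * hE
  · linear_combination ((q : ℂ)^2 + q + 1) * q *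
      (s1 * s2 * (b1 + b3) + s1 * s3 * (b2 + b5) + s2 * s3 * (b4 + b6))
      - q * (s2 * s3 + s1 * s3 + s1 * s2) * hE

theorem fs_plus_zero (h12 : s1 ≠ s2) (h13 : s1 ≠ s3) (h23 : s2 ≠ s3) (m : ℕ) :
    fs q s1 s2 s3 (m+2) 0 + ((q : ℂ)^2 + q) * fs q s1 s2 s3 (m+1) 1 =
      q * (s1 + s2 + s3) * fs q s1 s2 s3 (m+1) 0 := by
  have r1 := Bc_rel_right q s1 s2 s3
  have r2 := Bc_rel_right q s2 s1 s3
  have r3 := Bc_rel_right q s3 s1 s2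
  unfold fs
  linear_combination (q : ℂ)^m * q^2 * (s1^m * s1 * r1 + s2^m * s2 * r2 + s3^m * s3 * r3)

theorem fs_plus_int (hprod : s1 * s2 * s3 = 1) (m n : ℕ) :
    (q : ℂ)^2 * fs q s1 s2 s3 m n + (q : ℂ) * fs q s1 s2 s3 (m+1) (n+2)
      + fs q s1 s2 s3 (m+2) (n+1) =
      q * (s1 + s2 + s3) * fs q s1 s2 s3 (m+1) (n+1) := by
  have key : (q : ℂ)^2 * fs q s1 s2 s3 m n * (s1 * s2 * s3)
      + (q : ℂ) * fs q s1 s2 s3 (m+1) (n+2) + fs q s1 s2 s3 (m+2) (n+1) =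
      q * (s1 + s2 + s3) * fs q s1 s2 s3 (m+1) (n+1) := by
    unfold fs
    ring
  rw [hprod, mul_one] at key
  exact key

theorem fs_plus_diag (hprod : s1 * s2 * s3 = 1)
    (h12 : s1 ≠ s2) (h13 : s1 ≠ s3) (h23 : s2 ≠ s3) (m : ℕ) :
    (q : ℂ)^2 * fs q s1 s2 s3 m m + ((q : ℂ) + 1) * fs q s1 s2 s3 (m+2) (m+1) =
      q * (s1 + s2 + s3) * fs q s1 s2 s3 (m+1) (m+1) := by
  have t3 := Bc_rel_left q s1 s2 s3
  have t2 := Bc_rel_left q s1 s3 s2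
  have t1 := Bc_rel_left q s2 s3 s1
  rw [← fs_plus_int q s1 s2 s3 hprod m m]
  unfold fs
  linear_combination (q : ℂ)^m * q^2 * (s1^m * s2^m * s1 * s2 * t3 + s1^m * s3^m * s1 * s3 * t2
    + s2^m * s3^m * s2 * s3 * t1)

theorem fs_minus_diag (hprod : s1 * s2 * s3 = 1)
    (h12 : s1 ≠ s2) (h13 : s1 ≠ s3) (h23 : s2 ≠ s3) (m : ℕ) :
    ((q : ℂ)^2 + q) * fs q s1 s2 s3 (m+1) m + fs q s1 s2 s3 (m+2) (m+2) =
      q * (s2 * s3 + s1 * s3 + s1 * s2) * fs q s1 s2 s3 (m+1) (m+1) := by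
  have t3 := Bc_rel_left q s1 s2 s3
  have t2 := Bc_rel_left q s1 s3 s2
  have t1 := Bc_rel_left q s2 s3 s1
  have key : (q : ℂ)^2 * fs q s1 s2 s3 m (m+1) * (s1 * s2 * s3)
      + (q : ℂ) * fs q s1 s2 s3 (m+1) m * (s1 * s2 * s3) + fs q s1 s2 s3 (m+2) (m+2) =
      q * (s2 * s3 + s1 * s3 + s1 * s2) * fs q s1 s2 s3 (m+1) (m+1) := by
    unfold fs
    ring
  rw [hprod, mul_one, mul_one] at key
  rw [← key]
  unfold fs
  linear_combination (q : ℂ)^m * q^2 * (s1^m * s2^m * t3 + s1^m * s3^m * t2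
    + s2^m * s3^m * t1)

end helpers

/-- For `(s₁,s₂,s₃) ∈ S` pairwise distinct, a simultaneous `(λ⁺,λ⁻)`-eigenfunction `f`
with `f(v_{0,0}) = 1` is given by `f(v_{m,n}) = Σ_{(i,j), i≠j} B_{i,j} q^m s_i^m s_j^n`. -/
theorem eigenfunction_formula_distinct (q : ℕ) (hq2 : 2 ≤ q) (hq : IsPrimePow q)
    (s1 s2 s3 : ℂ)
    (hprod : s1 * s2 * s3 = 1)
    (hconj : (starRingEnd ℂ) (s1 + s2 + s3) = s1⁻¹ + s2⁻¹ + s3⁻¹)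
    (h12 : s1 ≠ s2) (h13 : s1 ≠ s3) (h23 : s2 ≠ s3)
    (f : ℕ → ℕ → ℂ)
    (hf : IsEigen q f ((q : ℂ) * (s1 + s2 + s3)) ((q : ℂ) * (s1⁻¹ + s2⁻¹ + s3⁻¹)))
    (h0 : f 0 0 = 1) :
    ∀ m n : ℕ, n ≤ m → f m n = fs q s1 s2 s3 m n := by
  have a1 := aux_q1 q
  have a2 := aux_q2 q
  have n1 : s1 ≠ 0 := by rintro rfl; simp at hprod
  have n2 : s2 ≠ 0 := by rintro rfl; simp at hprod
  have n3 : s3 ≠ 0 := by rintro rfl; simp at hprod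
  have hinv : s1⁻¹ + s2⁻¹ + s3⁻¹ = s2 * s3 + s1 * s3 + s1 * s2 := by
    rw [inv_eq_of_mul_eq_one_right (show s1 * (s2 * s3) = 1 by linear_combination hprod),
      inv_eq_of_mul_eq_one_right (show s2 * (s1 * s3) = 1 by linear_combination hprod),
      inv_eq_of_mul_eq_one_right (show s3 * (s1 * s2) = 1 by linear_combination hprod)]
  rw [hinv] at hf
  obtain ⟨c0, c1, c2⟩ := fs_base q s1 s2 s3 h12 h13 h23
  have main : ∀ m : ℕ, (∀ n ≤ m, f m n = fs q s1 s2 s3 m n) ∧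
      (∀ n ≤ m + 1, f (m+1) n = fs q s1 s2 s3 (m+1) n) := by
    intro m
    induction m with
    | zero =>
      have h := hf 0 0 le_rfl
      simp only [Aplus, Aminus, if_true, h0, mul_one] at h
      refine ⟨?_, ?_⟩
      · intro n hn
        obtain rfl : n = 0 := by omega
        rw [h0, c0]
      · intro n hn
        obtain rfl | rfl : n = 0 ∨ n = 1 := by omega
        · exact mul_left_cancel₀ a2 (h.1.trans c1.symm)
        · exact mul_left_cancel₀ a2 (h.2.trans c2.symm)
    | succ m ih =>
      obtain ⟨ih0, ih1⟩ := ih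
      refine ⟨ih1, ?_⟩
      intro n hn
      rcases Nat.lt_or_ge (m+1) n with hlt | hle
      · obtain rfl : n = m + 2 := by omega
        have h := (hf (m+1) (m+1) le_rfl).2
        simp only [Aminus, Nat.succ_ne_zero, if_false, if_true, Nat.add_sub_cancel] at h
        rw [ih1 m (by omega), ih1 (m+1) le_rfl,
          ← fs_minus_diag q s1 s2 s3 hprod h12 h13 h23 m] at h
        exact add_left_cancel h
      · have h := (hf (m+1) n hle).1
        rcases n with _ | n
        · simp only [Aplus, Nat.succ_ne_zero, if_false, if_true] at h
          rw [ih1 1 (by omega), ih1 0 (by omega),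
            ← fs_plus_zero q s1 s2 s3 h12 h13 h23 m] at h
          exact add_right_cancel h
        · by_cases hnm : n = m
          · subst hnm
            simp only [Aplus, Nat.succ_ne_zero, if_false, if_true, Nat.add_sub_cancel] at h
            rw [ih0 n le_rfl, ih1 (n+1) le_rfl,
              ← fs_plus_diag q s1 s2 s3 hprod h12 h13 h23 n] at h
            exact mul_left_cancel₀ a1 (add_left_cancel h)
          · have hne : n + 1 ≠ m + 1 := by omega
            simp only [Aplus, Nat.succ_ne_zero, if_false, hne, Nat.add_sub_cancel] at h
            rw [ih0 n (by omega), ih1 (n+1+1) (by omega), ih1 (n+1) (by omega),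
              ← fs_plus_int q s1 s2 s3 hprod m n] at h
            exact add_left_cancel h
  intro m n hn
  exact (main m).1 n hn
end
end

section
/- For every ω ∈ ℂ with ω³ = 1, the function f : V → ℂ defined by f(v_{m,n}) = ω^{m+n} satisfies A_w^+f(v) = (q²+q+1)ω f(v) and A_w^−f(v) = (q²+q+1)ω² f(v) for every v ∈ V, and f ∈ L²_w, i.e. ‖f‖²_w < ∞. -/
set_option linter.unusedSectionVars false

noncomputable section

open Filter

/-- For any cube root of unity `ω`, the function `f(v_{m,n}) = ω^{m+n}` is a simultaneous
eigenfunction of `A_w^±` with eigenvalues `(q²+q+1)ω` and `(q²+q+1)ω²`, and lies in `L²_w`. -/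
theorem trivial_eigenfunction (q : ℕ) (hq2 : 2 ≤ q) (hq : IsPrimePow q)
    (ω : ℂ) (hω : ω^3 = 1) :
    (∀ m n : ℕ, n ≤ m →
      Aplus q (fun m n => ω^(m+n)) m n = ((q : ℂ)^2 + q + 1) * ω * ω^(m+n) ∧
      Aminus q (fun m n => ω^(m+n)) m n = ((q : ℂ)^2 + q + 1) * ω^2 * ω^(m+n)) ∧
    MemL2 q (fun m n => ω^(m+n)) := by
  refine ⟨?_, ?_⟩
  · intro m n hnm
    rcases m with _ | a
    · obtain rfl : n = 0 := by omega
      constructor <;> simp [Aplus, Aminus]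
    · rcases n with _ | b
      · constructor
        · simp only [Aplus, Nat.add_eq_zero_iff, one_ne_zero, and_false, if_false, if_true]
          ring
        · simp only [Aminus, Nat.add_eq_zero_iff, one_ne_zero, and_false, if_false, if_true,
            Nat.add_sub_cancel]
          linear_combination (-(q : ℂ)^2 * ω^a) * hω
      · by_cases hab : b = a
        · subst hab
          constructor
          · simp only [Aplus, Nat.add_eq_zero_iff, one_ne_zero, and_false, if_false, if_true,
              Nat.add_sub_cancel]
            linear_combination (-(q : ℂ)^2 * ω^(b+b)) * hω
          · simp only [Aminus, Nat.add_eq_zero_iff, one_ne_zero, and_false, if_false, if_true,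
              Nat.add_sub_cancel]
            linear_combination (-((q : ℂ)^2 + q) * ω^(b+b+1)) * hω
        · have hab' : ¬ (b + 1 = a + 1) := by omega
          constructor
          · simp only [Aplus, Nat.add_eq_zero_iff, one_ne_zero, and_false, if_false, hab',
              Nat.add_sub_cancel]
            linear_combination (-(q : ℂ)^2 * ω^(a+b)) * hω
          · simp only [Aminus, Nat.add_eq_zero_iff, one_ne_zero, and_false, if_false, hab',
              Nat.add_sub_cancel]
            linear_combination (-((q : ℂ)^2 + q) * ω^(a+b+1)) * hω
  · have hn : ‖ω‖ = 1 := Complex.norm_eq_one_of_pow_eq_one hω (by norm_num)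
    have hq1 : (2 : ℝ) ≤ q := by exact_mod_cast hq2
    have hq0 : (0 : ℝ) < q := by linarith
    have hg : Summable fun n : ℕ => ((q : ℝ)⁻¹)^n :=
      summable_geometric_of_lt_one (by positivity) (inv_lt_one_of_one_lt₀ (by linarith))
    have hs : Summable fun p : ℕ × ℕ => ((q : ℝ)⁻¹)^p.1 * ((q : ℝ)⁻¹)^p.2 :=
      hg.mul_of_nonneg hg (fun _ => by positivity) (fun _ => by positivity)
    have hs2 : Summable fun p : Vtx =>
        ((q : ℝ) + 1) * (((q : ℝ)⁻¹)^p.1.1 * ((q : ℝ)⁻¹)^p.1.2) :=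
      (hs.mul_left ((q : ℝ) + 1)).comp_injective
        (Subtype.val_injective (p := fun p : ℕ × ℕ => p.2 ≤ p.1))
    unfold MemL2
    refine Summable.of_nonneg_of_le ?_ ?_ hs2
    · intro p
      have : 0 ≤ wt q p.1 := by
        unfold wt
        split_ifs <;> positivity
      positivity
    · rintro ⟨⟨m, n⟩, hnm⟩
      have hnm' : n ≤ m := hnm
      simp only [norm_pow, hn, one_pow, one_mul]
      have key : ((q : ℝ) + 1) / (q : ℝ)^(2 * m)
          ≤ ((q : ℝ) + 1) * (((q : ℝ)⁻¹)^m * ((q : ℝ)⁻¹)^n) := by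
        rw [div_eq_mul_inv, ← pow_add, inv_pow]
        have h : (q : ℝ)^(m+n) ≤ (q : ℝ)^(2*m) :=
          pow_le_pow_right₀ (by linarith) (by omega)
        gcongr
      refine le_trans ?_ key
      unfold wt
      dsimp only
      split_ifs with h1 h2
      · subst h1
        simp only [mul_zero, pow_zero, div_one]
        rw [div_le_iff₀ (by positivity)]
        nlinarith [sq_nonneg (q : ℝ)]
      · gcongr
        linarith
      · exact le_rfl
end
end

section
/- Let (s₁,s₂,s₃) ∈ S and let f : V → ℂ be a simultaneous (λ⁺,λ⁻)-eigenfunction with f(v_{0,0}) = 1. If ‖f‖²_w < ∞, then there exists ω ∈ ℂ with ω³ = 1 such that f(v_{m,n}) = ω^{m+n} for every (m,n) ∈ V (equivalently, f is a trivial eigenfunction, with λ⁺ = (q²+q+1)ω). -/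
set_option linter.unusedSectionVars false

noncomputable section

open Filter

/-- A decaying solution of `k (m+1) = s * k m` with `|s| ≥ 1` vanishes. -/
lemma decay_one (s : ℂ) (hs : 1 ≤ ‖s‖) (k : ℕ → ℂ) (hk : ∀ m, k (m+1) = s * k m)
    (ht : Tendsto k atTop (nhds 0)) : ∀ m, k m = 0 := by
  intro m
  have hmono : Monotone fun m => ‖k m‖ := by
    refine monotone_nat_of_le_succ fun n => ?_
    rw [hk, norm_mul]
    nlinarith [norm_nonneg (k n)]
  have h1 : ‖k m‖ ≤ 0 := by
    have h2 : Tendsto (fun m => ‖k m‖) atTop (nhds 0) := by simpa using ht.norm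
    exact hmono.ge_of_tendsto h2 m
  exact norm_le_zero_iff.1 h1

/-- A decaying solution of the cubic recurrence with two roots of modulus `≥ 1`. -/
lemma decay_three (a b c : ℂ) (ha : 1 ≤ ‖a‖) (hb : 1 ≤ ‖b‖) (h : ℕ → ℂ)
    (hrec : ∀ m, h (m+3) - (a + b + c) * h (m+2) + (a*b + a*c + b*c) * h (m+1)
      - a * b * c * h m = 0)
    (ht : Tendsto h atTop (nhds 0)) : ∀ m, h (m+1) = c * h m := by
  have hsh : ∀ j, Tendsto (fun m => h (m+j)) atTop (nhds 0) := fun j =>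
    (tendsto_add_atTop_iff_nat j).2 ht
  have t1 : ∀ j, Tendsto (fun m => h (m+j+1) - c * h (m+j)) atTop (nhds 0) := by
    intro j
    simpa [add_assoc] using (hsh (j+1)).sub ((hsh j).const_mul c)
  have z := decay_one a ha (fun m => (h (m+1+1) - c * h (m+1)) - b * (h (m+0+1) - c * h (m+0)))
    (by
      intro m
      have := hrec m
      simp only [add_zero, add_assoc] at this ⊢
      norm_num at this ⊢
      linear_combination this)
    (by simpa using (t1 1).sub ((t1 0).const_mul b))
  have z2 := decay_one b hb (fun m => h (m+0+1) - c * h (m+0))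
    (by
      intro m
      have := z m
      simp only [add_zero] at this ⊢
      linear_combination this) (t1 0)
  intro m
  have := z2 m
  simp only [add_zero] at this
  linear_combination this

/-- The root set is stable under `s ↦ 1 / conj s`. -/
lemma root_refl (a b c : ℂ) (hp : a * b * c = 1)
    (hc : (starRingEnd ℂ) (a + b + c) = a * b + a * c + b * c) (x : ℂ)
    (hx : x = a ∨ x = b ∨ x = c) :
    (starRingEnd ℂ) x * a = 1 ∨ (starRingEnd ℂ) x * b = 1 ∨ (starRingEnd ℂ) x * c = 1 := by
  have hc2 : a + b + c = (starRingEnd ℂ) (a * b + a * c + b * c) := by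
    rw [← hc, Complex.conj_conj]
  have hp2 : (starRingEnd ℂ) (a * b * c) = 1 := by rw [hp]; simp
  have hx0 : (x - a) * (x - b) * (x - c) = 0 := by
    rcases hx with rfl | rfl | rfl <;> simp
  have hx1 : (starRingEnd ℂ) ((x - a) * (x - b) * (x - c)) = 0 := by rw [hx0]; simp
  simp only [map_mul, map_sub, map_add] at *
  have key : ((starRingEnd ℂ) x * a - 1) * ((starRingEnd ℂ) x * b - 1) *
      ((starRingEnd ℂ) x * c - 1) = 0 := by
    linear_combination hx1 + (starRingEnd ℂ x)^3 * hp + (starRingEnd ℂ x)^2 * hc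
      + (starRingEnd ℂ x) * hc2 + hp2
  rcases mul_eq_zero.1 key with h | h
  · rcases mul_eq_zero.1 h with h | h
    · exact Or.inl (sub_eq_zero.1 h)
    · exact Or.inr (Or.inl (sub_eq_zero.1 h))
  · exact Or.inr (Or.inr (sub_eq_zero.1 h))

/-- Two of the parameters cannot both have modulus `< 1`. -/
lemma not_two_small (a b c : ℂ) (hp : a * b * c = 1)
    (hc : (starRingEnd ℂ) (a + b + c) = a * b + a * c + b * c) (ha : ‖a‖ < 1) (hb : ‖b‖ < 1) :
    False := by
  have small : ∀ x y : ℂ, ‖x‖ < 1 → ‖y‖ < 1 → (starRingEnd ℂ) x * y ≠ 1 := by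
    intro x y hx hy h
    have h1 := congrArg norm h
    rw [norm_mul, Complex.norm_conj, norm_one] at h1
    nlinarith [norm_nonneg x, norm_nonneg y]
  have h1 : (starRingEnd ℂ) a * c = 1 := by
    rcases root_refl a b c hp hc a (by simp) with h | h | h
    · exact absurd h (small _ _ ha ha)
    · exact absurd h (small _ _ ha hb)
    · exact h
  have h2 := congrArg norm h1
  have h3 := congrArg norm hp
  rw [norm_mul, Complex.norm_conj, norm_one] at h2
  rw [norm_mul, norm_mul, norm_one] at h3
  nlinarith [norm_nonneg a, norm_nonneg b]

/-- The main argument, with the possibly small parameter in the last place. -/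
lemma main_aux (q : ℕ) (hq2 : 2 ≤ q) (a b c : ℂ) (hp : a * b * c = 1)
    (hc : (starRingEnd ℂ) (a + b + c) = a * b + a * c + b * c)
    (ha : 1 ≤ ‖a‖) (hb : 1 ≤ ‖b‖) (f : ℕ → ℕ → ℂ)
    (hf : IsEigen q f ((q : ℂ) * (a + b + c)) ((q : ℂ) * (a * b + a * c + b * c)))
    (h0 : f 0 0 = 1) (hL2 : MemL2 q f) :
    ∃ ω : ℂ, ω^3 = 1 ∧ (∀ m n : ℕ, n ≤ m → f m n = ω^(m+n)) ∧
      (q : ℂ) * (a + b + c) = ((q : ℂ)^2 + q + 1) * ω := by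
  have hq0 : (q : ℂ) ≠ 0 := by
    have : q ≠ 0 := by omega
    exact_mod_cast this
  have hq1 : (q : ℂ) + 1 ≠ 0 := by exact_mod_cast Nat.succ_ne_zero q
  have hqq : (q : ℂ)^2 + q + 1 ≠ 0 := by exact_mod_cast Nat.succ_ne_zero (q^2 + q)
  have hp0 : ∀ m, f (m+2) 0 + ((q : ℂ)^2 + q) * f (m+1) 1 = (q : ℂ) * (a + b + c) * f (m+1) 0 := by
    intro m
    simpa [Aplus] using (hf (m+1) 0 (by omega)).1
  have hm0 : ∀ m, (q : ℂ)^2 * f m 0 + ((q : ℂ) + 1) * f (m+2) 1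
      = (q : ℂ) * (a * b + a * c + b * c) * f (m+1) 0 := by
    intro m
    simpa [Aminus] using (hf (m+1) 0 (by omega)).2
  have h10 : ((q : ℂ)^2 + q + 1) * f 1 0 = (q : ℂ) * (a + b + c) := by
    simpa [Aplus, h0] using (hf 0 0 le_rfl).1
  have h11 : ((q : ℂ)^2 + q + 1) * f 1 1 = (q : ℂ) * (a * b + a * c + b * c) := by
    simpa [Aminus, h0] using (hf 0 0 le_rfl).2
  have ht : Tendsto (fun m => f m 0 / (q : ℂ)^m) atTop (nhds 0) := by
    have inj : Function.Injective (fun m : ℕ => (⟨(m+1, 0), Nat.zero_le _⟩ : Vtx)) := by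
      intro x y hxy
      have h1 := congrArg (fun p : Vtx => p.1.1) hxy
      simpa using h1
    have h1 := (hL2.comp_injective inj).tendsto_atTop_zero
    have h2 : Tendsto (fun m => ‖f (m+1) 0 / (q : ℂ)^(m+1)‖^2) atTop (nhds 0) := by
      refine h1.congr fun m => ?_
      show ‖f (m+1) 0‖^2 * wt q (m+1, 0) = _
      simp [wt, ← pow_mul, mul_comm, div_eq_mul_inv, mul_pow]
    have h3 : Tendsto (fun m => ‖f (m+1) 0 / (q : ℂ)^(m+1)‖) atTop (nhds 0) := by
      have := h2.sqrt
      simpa only [Real.sqrt_sq (norm_nonneg _), Real.sqrt_zero] using this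
    exact (tendsto_add_atTop_iff_nat 1).1 (tendsto_zero_iff_norm_tendsto_zero.2 h3)
  have hstep := decay_three a b c ha hb (fun m => f m 0 / (q : ℂ)^m) (by
      intro m
      have e1 := hp0 (m+1)
      have e2 := hm0 m
      simp only [pow_succ, add_assoc] at e1 e2 ⊢
      norm_num at e1 e2 ⊢
      field_simp
      linear_combination e1 - q * e2 - (q:ℂ)^3 * f m 0 * hp) ht
  have hcol : ∀ m, f m 0 = ((q : ℂ) * c)^m := by
    have : ∀ m, f m 0 / (q : ℂ)^m = c^m := by
      intro m
      induction m with
      | zero => simp [h0]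
      | succ k ih => rw [hstep k, ih, pow_succ]; ring
    intro m
    rw [mul_pow, ← this m]
    field_simp
  have hsum : a + b + c = ((q : ℂ)^2 + q + 1) * c := by
    rw [hcol 1] at h10
    apply mul_left_cancel₀ hq0
    linear_combination -h10
  have hsum2 : a * b + a * c + b * c = ((q : ℂ)^2 + q + 1) * (starRingEnd ℂ) c := by
    rw [← hc, hsum]; simp
  have f11 : f 1 1 = q * (starRingEnd ℂ) c := by
    apply mul_left_cancel₀ hqq
    rw [h11, hsum2]; ring
  have hkey : (q : ℂ) * c^2 = (starRingEnd ℂ) c := by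
    have e := hp0 0
    rw [hsum] at e
    simp only [zero_add, f11, hcol] at e
    apply mul_left_cancel₀ (mul_ne_zero (mul_ne_zero hq0 hq0) (mul_ne_zero hq0 hq1))
    linear_combination -(q:ℂ) * e
  have hc0 : c ≠ 0 := by rintro rfl; simp at hp
  have hnorm : (q : ℝ) * ‖c‖ = 1 := by
    have := congrArg norm hkey
    rw [norm_mul, norm_pow, Complex.norm_conj, Complex.norm_natCast] at this
    apply mul_left_cancel₀ (norm_ne_zero_iff.2 hc0)
    linear_combination this
  have hcube : ((q : ℂ) * c)^3 = 1 := by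
    have e : (starRingEnd ℂ) c * c = ((‖c‖^2 : ℝ) : ℂ) := by
      rw [mul_comm, Complex.mul_conj, Complex.normSq_eq_norm_sq]
    have e2 : (q : ℂ) * ((‖c‖ : ℝ) : ℂ) = 1 := by exact_mod_cast hnorm
    push_cast at e
    linear_combination (q:ℂ)^2 * c * hkey + (q:ℂ)^2 * e + (q * (‖c‖:ℂ) + 1) * e2
  refine ⟨(q : ℂ) * c, hcube, ?_, by rw [hsum]; ring⟩
  generalize hω : (q : ℂ) * c = ω at *
  have hl : (q : ℂ) * (a + b + c) = ((q : ℂ)^2 + q + 1) * ω := by rw [hsum, ← hω]; ring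
  have hrow : ∀ n, (∀ m, n ≤ m → f m n = ω^(m+n)) ∧
      (∀ m, n + 1 ≤ m → f m (n+1) = ω^(m+(n+1))) := by
    intro n
    induction n with
    | zero =>
      refine ⟨fun m _ => by simpa using hcol m, fun m hm => ?_⟩
      obtain ⟨k, rfl⟩ : ∃ k, m = k + 1 := ⟨m - 1, by omega⟩
      have e := hp0 k
      rw [hl, hcol, hcol] at e
      apply mul_left_cancel₀ (mul_ne_zero hq0 hq1)
      simp only [zero_add]
      linear_combination e
    | succ n ih =>
      refine ⟨ih.2, fun m hm => ?_⟩
      obtain ⟨k, rfl⟩ : ∃ k, m = k + 1 := ⟨m - 1, by omega⟩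
      have e := (hf (k+1) (n+1) (by omega)).1
      have hne : n ≠ k := by omega
      rw [hl] at e
      simp only [Aplus, Nat.add_eq_zero_iff, one_ne_zero, and_false, if_false,
        Nat.add_right_cancel_iff, hne, Nat.add_sub_cancel] at e
      rw [ih.1 k (by omega), ih.2 (k+1) (by omega), ih.2 (k+1+1) (by omega)] at e
      apply mul_left_cancel₀ hq0
      linear_combination e + (q : ℂ)^2 * ω^(k+n) * hcube
  exact fun m n hmn => (hrow n).1 m hmn

/-- The only simultaneous eigenfunctions (normalized by `f(v_{0,0}) = 1`) of `A_w^±` lying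
in `L²_w` are the trivial ones `f(v_{m,n}) = ω^{m+n}` with `ω³ = 1`, with
`λ⁺ = (q²+q+1)ω`. -/
theorem L2_eigenfunction_trivial (q : ℕ) (hq2 : 2 ≤ q) (hq : IsPrimePow q)
    (s1 s2 s3 : ℂ)
    (hprod : s1 * s2 * s3 = 1)
    (hconj : (starRingEnd ℂ) (s1 + s2 + s3) = s1⁻¹ + s2⁻¹ + s3⁻¹)
    (f : ℕ → ℕ → ℂ)
    (hf : IsEigen q f ((q : ℂ) * (s1 + s2 + s3)) ((q : ℂ) * (s1⁻¹ + s2⁻¹ + s3⁻¹)))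
    (h0 : f 0 0 = 1)
    (hL2 : MemL2 q f) :
    ∃ ω : ℂ, ω^3 = 1 ∧ (∀ m n : ℕ, n ≤ m → f m n = ω^(m+n)) ∧
      (q : ℂ) * (s1 + s2 + s3) = ((q : ℂ)^2 + q + 1) * ω := by
  have i1 : s1 ≠ 0 := by rintro rfl; simp at hprod
  have i2 : s2 ≠ 0 := by rintro rfl; simp at hprod
  have i3 : s3 ≠ 0 := by rintro rfl; simp at hprod
  have he : s1⁻¹ + s2⁻¹ + s3⁻¹ = s1 * s2 + s1 * s3 + s2 * s3 := by
    rw [inv_eq_of_mul_eq_one_right (a := s1) (b := s2 * s3) (by linear_combination hprod),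
      inv_eq_of_mul_eq_one_right (a := s2) (b := s1 * s3) (by linear_combination hprod),
      inv_eq_of_mul_eq_one_right (a := s3) (b := s1 * s2) (by linear_combination hprod)]
    ring
  rw [he] at hconj hf
  by_cases h1 : 1 ≤ ‖s1‖
  · by_cases h2 : 1 ≤ ‖s2‖
    · exact main_aux q hq2 s1 s2 s3 hprod hconj h1 h2 f hf h0 hL2
    · have h3 : 1 ≤ ‖s3‖ := by
        by_contra h3
        refine not_two_small s2 s3 s1 (by linear_combination hprod) ?_ (not_le.1 h2) (not_le.1 h3)
        rw [show s2 + s3 + s1 = s1 + s2 + s3 by ring, hconj]; ring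
      have e1 : s1 + s2 + s3 = s1 + s3 + s2 := by ring
      have e2 : s1 * s2 + s1 * s3 + s2 * s3 = s1 * s3 + s1 * s2 + s3 * s2 := by ring
      rw [e1, e2] at hconj hf
      rw [e1]
      exact main_aux q hq2 s1 s3 s2 (by linear_combination hprod) hconj h1 h3 f hf h0 hL2
  · have h2 : 1 ≤ ‖s2‖ := by
      by_contra h2
      exact not_two_small s1 s2 s3 hprod hconj (not_le.1 h1) (not_le.1 h2)
    have h3 : 1 ≤ ‖s3‖ := by
      by_contra h3
      refine not_two_small s1 s3 s2 (by linear_combination hprod) ?_ (not_le.1 h1) (not_le.1 h3)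
      rw [show s1 + s3 + s2 = s1 + s2 + s3 by ring, hconj]; ring
    have e1 : s1 + s2 + s3 = s2 + s3 + s1 := by ring
    have e2 : s1 * s2 + s1 * s3 + s2 * s3 = s2 * s3 + s2 * s1 + s3 * s1 := by ring
    rw [e1, e2] at hconj hf
    rw [e1]
    exact main_aux q hq2 s2 s3 s1 (by linear_combination hprod) hconj h2 h3 f hf h0 hL2
end
end

section
/- The operators A_w^+ and A_w^− are bounded on L²_w with operator norm q²+q+1: for every f : V → ℂ with ‖f‖²_w < ∞ one has ‖A_w^+f‖²_w ≤ (q²+q+1)²‖f‖²_w and ‖A_w^−f‖²_w ≤ (q²+q+1)²‖f‖²_w, and the constant is optimal, since the constant function f ≡ 1 lies in L²_w, is nonzero, and satisfies A_w^±f = (q²+q+1)f. -/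
set_option linter.unusedSectionVars false

noncomputable section

open Filter

lemma tsum_le_of_map {V : Type} (T G : V → ℝ) (σ : V → V) (hT : ∀ v, 0 ≤ T v) (hG : ∀ v, 0 ≤ G v)
    (hinj : ∀ v v', T v ≠ 0 → T v' ≠ 0 → σ v = σ v' → v = v')
    (h : ∀ v, T v ≠ 0 → T v = G (σ v)) (hs : Summable G) :
    Summable T ∧ ∑' v, T v ≤ ∑' v, G v := by
  set e : Function.support T → V := fun v => σ v.1 with he
  have hi : Function.Injective e := by
    intro v v' hv
    exact Subtype.ext (hinj v.1 v'.1 v.2 v'.2 hv)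
  have h1 : Summable (fun v : Function.support T => G (e v)) := hs.comp_injective hi
  have h2 : (fun v : Function.support T => G (e v)) = fun v : Function.support T => T v.1 := by
    funext v
    exact (h v.1 v.2).symm
  have h3 : Summable (fun v : Function.support T => T v.1) := h2 ▸ h1
  constructor
  · refine (Function.Injective.summable_iff (f := T)
      (g := (Subtype.val : Function.support T → V)) Subtype.val_injective ?_).1 h3
    intro x hx
    by_contra hne
    exact hx ⟨⟨x, hne⟩, rfl⟩
  · rw [← tsum_subtype_support T]
    exact Summable.tsum_le_tsum_of_inj e hi (fun c _ => hG c) (fun v => (h v.1 v.2).le) h3 hs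

lemma schur_abs {V : Type} (w F H : V → ℝ) (K : ℝ) (hK : 0 ≤ K)
    (c r : Fin 3 → V → ℝ) (σ : Fin 3 → V → V)
    (hw : ∀ v, 0 ≤ w v) (hF : ∀ v, 0 ≤ F v) (hH : ∀ v, 0 ≤ H v)
    (hc : ∀ i v, 0 ≤ c i v) (hr : ∀ i v, 0 ≤ r i v)
    (hb : ∀ v, H v ≤ K * (c 0 v * F (σ 0 v) + c 1 v * F (σ 1 v) + c 2 v * F (σ 2 v)))
    (hinj : ∀ i v v', c i v ≠ 0 → c i v' ≠ 0 → σ i v = σ i v' → v = v')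
    (hbal : ∀ i v, c i v ≠ 0 → w v * c i v = r i (σ i v) * w (σ i v))
    (hrs : ∀ v, r 0 v + r 1 v + r 2 v = K)
    (hs : Summable fun v => F v * w v) :
    Summable (fun v => H v * w v) ∧ ∑' v, H v * w v ≤ K ^ 2 * ∑' v, F v * w v := by
  have hrK : ∀ i v, r i v ≤ K := by
    intro i v
    have := hrs v
    have h0 := hr 0 v
    have h1 := hr 1 v
    have h2 := hr 2 v
    obtain rfl | rfl | rfl : i = 0 ∨ i = 1 ∨ i = 2 := by omega
    all_goals linarith
  have hFw : ∀ v, 0 ≤ F v * w v := fun v => mul_nonneg (hF v) (hw v)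
  have hGs : ∀ i, Summable fun v => r i v * (F v * w v) := by
    intro i
    refine Summable.of_nonneg_of_le (fun v => mul_nonneg (hr i v) (hFw v))
      (fun v => mul_le_mul_of_nonneg_right (hrK i v) (hFw v)) (hs.mul_left K)
  have key : ∀ i, Summable (fun v => w v * c i v * F (σ i v)) ∧
      ∑' v, w v * c i v * F (σ i v) ≤ ∑' v, r i v * (F v * w v) := by
    intro i
    have hne : ∀ v, w v * c i v * F (σ i v) ≠ 0 → c i v ≠ 0 := by
      intro v hv h0
      exact hv (by rw [h0]; ring)
    refine tsum_le_of_map (fun v => w v * c i v * F (σ i v)) (fun v => r i v * (F v * w v)) (σ i)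
      (fun v => mul_nonneg (mul_nonneg (hw v) (hc i v)) (hF _))
      (fun v => mul_nonneg (hr i v) (hFw v)) ?_ ?_ (hGs i)
    · intro v v' h h'
      exact hinj i v v' (hne v h) (hne v' h')
    · intro v hv
      have := hbal i v (hne v hv)
      rw [this]; ring
  obtain ⟨s0, t0⟩ := key 0
  obtain ⟨s1, t1⟩ := key 1
  obtain ⟨s2, t2⟩ := key 2
  have hle : ∀ v, H v * w v ≤ K * (w v * c 0 v * F (σ 0 v) + w v * c 1 v * F (σ 1 v)
      + w v * c 2 v * F (σ 2 v)) := by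
    intro v
    have := mul_le_mul_of_nonneg_right (hb v) (hw v)
    linarith
  have hS := ((s0.add s1).add s2).mul_left K
  have hHs : Summable (fun v => H v * w v) :=
    Summable.of_nonneg_of_le (fun v => mul_nonneg (hH v) (hw v)) hle hS
  refine ⟨hHs, (hHs.tsum_le_tsum hle hS).trans ?_⟩
  rw [tsum_mul_left, (s0.add s1).tsum_add s2, s0.tsum_add s1]
  have e : K * ∑' v, F v * w v = ∑' v, r 0 v * (F v * w v) + ∑' v, r 1 v * (F v * w v)
      + ∑' v, r 2 v * (F v * w v) := by
    rw [← (hGs 0).tsum_add (hGs 1), ← ((hGs 0).add (hGs 1)).tsum_add (hGs 2), ← tsum_mul_left]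
    congr 1
    funext v
    rw [← hrs v]; ring
  rw [pow_two, mul_assoc, e]
  exact mul_le_mul_of_nonneg_left (by linarith) hK

lemma conv3 (a b c : ℝ) (ha : 0 ≤ a) (hb : 0 ≤ b) (hc : 0 ≤ c) (x y z : ℂ) :
    ‖(a : ℂ) * x + b * y + c * z‖ ^ 2 ≤
      (a + b + c) * (a * ‖x‖ ^ 2 + b * ‖y‖ ^ 2 + c * ‖z‖ ^ 2) := by
  have h : ‖(a : ℂ) * x + b * y + c * z‖ ≤ a * ‖x‖ + b * ‖y‖ + c * ‖z‖ := by
    refine (norm_add₃_le).trans ?_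
    simp [abs_of_nonneg, ha, hb, hc]
  refine (pow_le_pow_left₀ (norm_nonneg _) h 2).trans ?_
  nlinarith [mul_nonneg (mul_nonneg ha hb) (sq_nonneg (‖x‖ - ‖y‖)),
    mul_nonneg (mul_nonneg ha hc) (sq_nonneg (‖x‖ - ‖z‖)),
    mul_nonneg (mul_nonneg hb hc) (sq_nonneg (‖y‖ - ‖z‖))]

/-- Forward coefficients (those of `A⁺`), by edge direction. -/
def cF (q : ℕ) (i : Fin 3) (v : Vtx) : ℝ :=
  match i with
  | 0 => if v.1.2 = 0 then 0 else (q : ℝ) ^ 2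
  | 1 => if v.1.2 = v.1.1 then 0 else if v.1.2 = 0 then (q : ℝ) ^ 2 + q else q
  | 2 => if v.1.1 = 0 then (q : ℝ) ^ 2 + q + 1 else if v.1.2 = v.1.1 then (q : ℝ) + 1 else 1

/-- Backward coefficients (those of `A⁻`), by edge direction. -/
def cB (q : ℕ) (i : Fin 3) (v : Vtx) : ℝ :=
  match i with
  | 0 => if v.1.1 = 0 then (q : ℝ) ^ 2 + q + 1 else if v.1.2 = 0 then (q : ℝ) + 1 else 1
  | 1 => if v.1.2 = 0 then 0 else if v.1.2 = v.1.1 then (q : ℝ) ^ 2 + q else q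
  | 2 => if v.1.2 = v.1.1 then 0 else (q : ℝ) ^ 2

/-- Forward neighbour maps. -/
def sF (i : Fin 3) (v : Vtx) : Vtx :=
  match i with
  | 0 => ⟨(v.1.1 - 1, v.1.2 - 1), Nat.sub_le_sub_right v.2 1⟩
  | 1 => ⟨(v.1.1, min (v.1.2 + 1) v.1.1), min_le_right _ _⟩
  | 2 => ⟨(v.1.1 + 1, v.1.2), Nat.le_succ_of_le v.2⟩

/-- Backward neighbour maps. -/
def sB (i : Fin 3) (v : Vtx) : Vtx :=
  match i with
  | 0 => ⟨(v.1.1 + 1, v.1.2 + 1), Nat.succ_le_succ v.2⟩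
  | 1 => ⟨(v.1.1, v.1.2 - 1), (Nat.sub_le _ _).trans v.2⟩
  | 2 => ⟨(v.1.1 - 1, min v.1.2 (v.1.1 - 1)), min_le_right _ _⟩

lemma cF_nonneg (q : ℕ) (i : Fin 3) (v : Vtx) : 0 ≤ cF q i v := by
  fin_cases i <;> simp only [cF] <;> split_ifs <;> positivity

lemma cB_nonneg (q : ℕ) (i : Fin 3) (v : Vtx) : 0 ≤ cB q i v := by
  fin_cases i <;> simp only [cB] <;> split_ifs <;> positivity

lemma cF_sum (q : ℕ) (v : Vtx) : cF q 0 v + cF q 1 v + cF q 2 v = (q : ℝ) ^ 2 + q + 1 := by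
  obtain ⟨⟨m, n⟩, h⟩ := v
  simp only at h
  simp only [cF]
  split_ifs <;> first | (exfalso; omega) | ring

lemma cB_sum (q : ℕ) (v : Vtx) : cB q 0 v + cB q 1 v + cB q 2 v = (q : ℝ) ^ 2 + q + 1 := by
  obtain ⟨⟨m, n⟩, h⟩ := v
  simp only at h
  simp only [cB]
  split_ifs <;> first | (exfalso; omega) | ring

lemma wt_nonneg (q : ℕ) (p : ℕ × ℕ) : 0 ≤ wt q p := by
  unfold wt
  split_ifs <;> positivity

lemma vtx_ext {v v' : Vtx} (h1 : v.1.1 = v'.1.1) (h2 : v.1.2 = v'.1.2) : v = v' :=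
  Subtype.ext (Prod.ext h1 h2)

lemma sB_sF (q : ℕ) (i : Fin 3) (v : Vtx) (h : cF q i v ≠ 0) : sB i (sF i v) = v := by
  obtain ⟨⟨m, n⟩, hv⟩ := v
  simp only at hv
  fin_cases i <;> simp only [cF] at h <;> split_ifs at h <;>
    first
    | exact absurd rfl h
    | (apply vtx_ext <;> simp [sF, sB] <;> omega)

lemma sF_sB (q : ℕ) (i : Fin 3) (v : Vtx) (h : cB q i v ≠ 0) : sF i (sB i v) = v := by
  obtain ⟨⟨m, n⟩, hv⟩ := v
  simp only at hv
  fin_cases i <;> simp only [cB] at h <;> split_ifs at h <;>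
    first
    | exact absurd rfl h
    | (apply vtx_ext <;> simp [sF, sB] <;> omega)

lemma balF (q : ℕ) (hq : 2 ≤ q) (i : Fin 3) (v : Vtx) (h : cF q i v ≠ 0) :
    wt q v.1 * cF q i v = cB q i (sF i v) * wt q (sF i v).1 := by
  have hq0 : (q : ℝ) ≠ 0 := by positivity
  have hK : (q : ℝ) ^ 2 + q + 1 ≠ 0 := by positivity
  obtain ⟨⟨m, n⟩, hv⟩ := v
  simp only at hv
  fin_cases i
  · obtain _ | n := n
    · simp [cF] at h
    obtain _ | m := m
    · omega
    simp only [cF, cB, sF, wt, Nat.add_sub_cancel, Nat.add_eq_zero_iff, one_ne_zero, and_false, false_or, if_false]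
    clear h
    split_ifs <;> first | (exfalso; omega) | (subst_vars; field_simp; done) | (subst_vars; field_simp; ring)
  · have hlt : n < m := by
      rcases Nat.lt_or_ge n m with h' | h'
      · exact h'
      · have : n = m := by omega
        simp [cF, this] at h
    have hm : min (n + 1) m = n + 1 := by omega
    simp only [cF, cB, sF, wt, hm, Nat.add_eq_zero_iff, one_ne_zero, and_false, false_or, if_false]
    clear h
    split_ifs <;> first | (exfalso; omega) | (subst_vars; field_simp; done) | (subst_vars; field_simp; ring)
  · have hne : ¬ n = m + 1 := by omega
    simp only [cF, cB, sF, wt, hne, Nat.add_eq_zero_iff, one_ne_zero, and_false, or_false, if_false]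
    clear h
    split_ifs <;> first | (exfalso; omega) | (subst_vars; field_simp; done) | (subst_vars; field_simp; ring)

lemma cB_ne (q : ℕ) (hq : 2 ≤ q) (i : Fin 3) (v : Vtx) (h : cB q i v ≠ 0) :
    cF q i (sB i v) ≠ 0 := by
  have hq0 : 0 < (q : ℝ) := by positivity
  obtain ⟨⟨m, n⟩, hv⟩ := v
  simp only at hv
  fin_cases i <;> simp only [cB] at h <;> simp only [cF, sB] <;> split_ifs at h <;>
    first
    | exact absurd rfl h
    | (split_ifs <;> first | (exfalso; omega) | positivity | (show (if n - 1 = m then (0 : ℝ) else if n - 1 = 0 then (q : ℝ) ^ 2 + q else q) ≠ 0; rw [if_neg (by omega)]; split_ifs <;> positivity))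

lemma balB (q : ℕ) (hq : 2 ≤ q) (i : Fin 3) (v : Vtx) (h : cB q i v ≠ 0) :
    wt q v.1 * cB q i v = cF q i (sB i v) * wt q (sB i v).1 := by
  have h1 := balF q hq i (sB i v) (cB_ne q hq i v h)
  rw [sF_sB q i v h] at h1
  linarith

lemma Aplus_eq (q : ℕ) (f : ℕ → ℕ → ℂ) (v : Vtx) : Aplus q f v.1.1 v.1.2 =
    (cF q 0 v : ℂ) * f (sF 0 v).1.1 (sF 0 v).1.2 + cF q 1 v * f (sF 1 v).1.1 (sF 1 v).1.2
      + cF q 2 v * f (sF 2 v).1.1 (sF 2 v).1.2 := by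
  obtain ⟨⟨m, n⟩, hv⟩ := v
  simp only at hv
  simp only [Aplus, cF, sF]
  by_cases hm : m = 0
  · obtain rfl : n = 0 := by omega
    subst hm
    simp
  by_cases hn : n = 0
  · subst hn
    have : min 1 m = 1 := by omega
    simp [hm, Ne.symm hm, this]
    ring
  by_cases hnm : n = m
  · subst hnm
    simp [hm]
  · have : min (n + 1) m = n + 1 := by omega
    simp [hm, hn, hnm, this]

lemma Aminus_eq (q : ℕ) (f : ℕ → ℕ → ℂ) (v : Vtx) : Aminus q f v.1.1 v.1.2 =
    (cB q 0 v : ℂ) * f (sB 0 v).1.1 (sB 0 v).1.2 + cB q 1 v * f (sB 1 v).1.1 (sB 1 v).1.2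
      + cB q 2 v * f (sB 2 v).1.1 (sB 2 v).1.2 := by
  obtain ⟨⟨m, n⟩, hv⟩ := v
  simp only at hv
  simp only [Aminus, cB, sB]
  by_cases hm : m = 0
  · obtain rfl : n = 0 := by omega
    subst hm
    simp
  by_cases hn : n = 0
  · subst hn
    simp [hm, Ne.symm hm]
    ring
  by_cases hnm : n = m
  · subst hnm
    simp [hm]
    ring
  · have : min n (m - 1) = n := by omega
    simp [hm, hn, hnm, this]
    ring

lemma Aplus_bound (q : ℕ) (hq : 2 ≤ q) (f : ℕ → ℕ → ℂ) (hf : MemL2 q f) :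
    MemL2 q (Aplus q f) ∧
      normSqW q (Aplus q f) ≤ ((q : ℝ)^2 + q + 1)^2 * normSqW q f := by
  refine schur_abs (fun v : Vtx => wt q v.1) (fun v : Vtx => ‖f v.1.1 v.1.2‖ ^ 2)
    (fun v : Vtx => ‖Aplus q f v.1.1 v.1.2‖ ^ 2) ((q : ℝ)^2 + q + 1) (by positivity)
    (cF q) (cB q) sF (fun v => wt_nonneg q v.1) (fun v => by positivity) (fun v => by positivity)
    (cF_nonneg q) (cB_nonneg q) ?_ ?_ (balF q hq) (cB_sum q) hf
  · intro v
    beta_reduce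
    rw [Aplus_eq, ← cF_sum q v]
    exact conv3 _ _ _ (cF_nonneg q 0 v) (cF_nonneg q 1 v) (cF_nonneg q 2 v) _ _ _
  · intro i v v' h h' e
    rw [← sB_sF q i v h, ← sB_sF q i v' h', e]

lemma Aminus_bound (q : ℕ) (hq : 2 ≤ q) (f : ℕ → ℕ → ℂ) (hf : MemL2 q f) :
    MemL2 q (Aminus q f) ∧
      normSqW q (Aminus q f) ≤ ((q : ℝ)^2 + q + 1)^2 * normSqW q f := by
  refine schur_abs (fun v : Vtx => wt q v.1) (fun v : Vtx => ‖f v.1.1 v.1.2‖ ^ 2)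
    (fun v : Vtx => ‖Aminus q f v.1.1 v.1.2‖ ^ 2) ((q : ℝ)^2 + q + 1) (by positivity)
    (cB q) (cF q) sB (fun v => wt_nonneg q v.1) (fun v => by positivity) (fun v => by positivity)
    (cB_nonneg q) (cF_nonneg q) ?_ ?_ (balB q hq) (cF_sum q) hf
  · intro v
    beta_reduce
    rw [Aminus_eq, ← cB_sum q v]
    exact conv3 _ _ _ (cB_nonneg q 0 v) (cB_nonneg q 1 v) (cB_nonneg q 2 v) _ _ _
  · intro i v v' h h' e
    rw [← sF_sB q i v h, ← sF_sB q i v' h', e]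

lemma one_mem (q : ℕ) (hq : 2 ≤ q) : MemL2 q (fun _ _ => (1 : ℂ)) := by
  have hq1 : (1 : ℝ) < q := by exact_mod_cast hq
  have hg : Summable fun n : ℕ => ((q : ℝ)⁻¹) ^ n :=
    summable_geometric_of_lt_one (by positivity) (inv_lt_one_of_one_lt₀ hq1)
  have h2 : Summable fun p : ℕ × ℕ => ((q : ℝ)⁻¹) ^ p.1 * ((q : ℝ)⁻¹) ^ p.2 :=
    hg.mul_of_nonneg hg (fun n => by positivity) (fun n => by positivity)
  have h3 : Summable fun v : Vtx => ((q : ℝ)⁻¹) ^ v.1.1 * ((q : ℝ)⁻¹) ^ v.1.2 :=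
    h2.comp_injective (i := fun v : Vtx => v.1) (fun a b h => Subtype.ext h)
  refine Summable.of_nonneg_of_le (fun v => mul_nonneg (by positivity) (wt_nonneg q v.1)) ?_
    (h3.mul_left ((q : ℝ) + 1))
  rintro ⟨⟨m, n⟩, hv⟩
  simp only at hv
  have hpow : 1 / (q : ℝ) ^ (2 * m) ≤ ((q : ℝ)⁻¹) ^ m * ((q : ℝ)⁻¹) ^ n := by
    have e : 1 / (q : ℝ) ^ (2 * m) = ((q : ℝ)⁻¹) ^ m * ((q : ℝ)⁻¹) ^ m := by
      rw [← pow_add, inv_pow, one_div, two_mul]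
    rw [e]
    exact mul_le_mul_of_nonneg_left
      (pow_le_pow_of_le_one (by positivity) (inv_lt_one_of_one_lt₀ hq1).le hv) (by positivity)
  have hp0 : 0 < 1 / (q : ℝ) ^ (2 * m) := by positivity
  simp only [norm_one, one_pow, one_mul]
  refine le_trans ?_ (mul_le_mul_of_nonneg_left hpow (by positivity))
  unfold wt
  simp only
  split_ifs with h1 h2
  · subst h1
    simp only [mul_zero, pow_zero, div_one, mul_one]
    rw [div_le_iff₀ (by positivity)]
    nlinarith
  · nlinarith
  · exact le_of_eq (by ring)

/-- `A_w^+` and `A_w^-` are bounded on `L²_w` with operator norm exactly `q²+q+1`: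
the bound `‖A_w^± f‖²_w ≤ (q²+q+1)² ‖f‖²_w` holds for all `f ∈ L²_w`, and the nonzero
constant function `1 ∈ L²_w` satisfies `A_w^± 1 = (q²+q+1) · 1`. -/
theorem operator_norm_bound (q : ℕ) (hq2 : 2 ≤ q) (hq : IsPrimePow q) :
    (∀ f : ℕ → ℕ → ℂ, MemL2 q f →
      MemL2 q (Aplus q f) ∧
      normSqW q (Aplus q f) ≤ ((q : ℝ)^2 + q + 1)^2 * normSqW q f ∧
      MemL2 q (Aminus q f) ∧
      normSqW q (Aminus q f) ≤ ((q : ℝ)^2 + q + 1)^2 * normSqW q f) ∧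
    MemL2 q (fun _ _ => (1 : ℂ)) ∧
    0 < normSqW q (fun _ _ => (1 : ℂ)) ∧
    (∀ m n : ℕ, n ≤ m →
      Aplus q (fun _ _ => (1 : ℂ)) m n = ((q : ℂ)^2 + q + 1) * 1 ∧
      Aminus q (fun _ _ => (1 : ℂ)) m n = ((q : ℂ)^2 + q + 1) * 1) := by
  refine ⟨fun f hf => ⟨(Aplus_bound q hq2 f hf).1, (Aplus_bound q hq2 f hf).2,
    (Aminus_bound q hq2 f hf).1, (Aminus_bound q hq2 f hf).2⟩, one_mem q hq2, ?_, ?_⟩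
  · refine (one_mem q hq2).tsum_pos
      (fun v => mul_nonneg (by positivity) (wt_nonneg q v.1)) ⟨(0, 0), le_refl 0⟩ ?_
    simp only [wt]
    simp
    positivity
  · intro m n _
    simp only [Aplus, Aminus]
    constructor <;> split_ifs <;> ring
end
end
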